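/- arXiv:1308.5844 — 3 statements merged into one kernel-verified Lean document; each statement's English description precedes it below -/
import Mathlib

section
/- If H is a sparse numerical semigroup of genus g > 1 that is symmetric (i.e., its Frobenius number satisfies ℓ_g = 2g - 1), then H is the hyperelliptic semigroup generated by 2 and 2g + 1, that is, H = {2k : k ∈ ℕ} ∪ {m ∈ ℕ : m ≥ 2g}. -/
/-- `H` is a numerical semigroup of genus `g`: it contains `0`, is closed under
addition, and its complement in `ℕ` (the set of gaps) is finite with exactly
`g` elements. -/
def IsNumericalSemigroupOfGenus (H : Set ℕ) (g : ℕ) : Prop :=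
  0 ∈ H ∧ (∀ a ∈ H, ∀ b ∈ H, a + b ∈ H) ∧ Hᶜ.Finite ∧ Hᶜ.ncard = g

/-- The `i`-th gap `ℓ_i` of `H` (1-indexed): the `i`-th smallest element of `ℕ \ H`.
In particular, if `H` has genus `g`, then `gap H g` is the Frobenius number of `H`. -/
noncomputable def gap (H : Set ℕ) (i : ℕ) : ℕ :=
  Nat.nth (fun n => n ∉ H) (i - 1)

/-- A numerical semigroup `H` of genus `g` is sparse if any two subsequent gaps
differ by at most `2`. -/
def IsSparse (H : Set ℕ) (g : ℕ) : Prop :=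
  ∀ i, 1 ≤ i → i ≤ g - 1 → gap H (i + 1) - gap H i ≤ 2

/-- `D`, the number of double leaps of `H` (of genus `g`). -/
noncomputable def numDouble (H : Set ℕ) (g : ℕ) : ℕ :=
  {i : ℕ | 1 ≤ i ∧ i ≤ g - 1 ∧ gap H (i + 1) - gap H i = 2}.ncard

/-- `S`, the number of single leaps of `H` (of genus `g`). -/
noncomputable def numSingle (H : Set ℕ) (g : ℕ) : ℕ :=
  {i : ℕ | 1 ≤ i ∧ i ≤ g - 1 ∧ gap H (i + 1) - gap H i = 1}.ncard

/-- In a numerical semigroup of genus `g`, every gap is at most `gap H g`. -/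
theorem le_gap_genus {H : Set ℕ} {g n : ℕ} (hfin : Hᶜ.Finite) (hcard : Hᶜ.ncard = g)
    (hn : n ∉ H) : n ≤ gap H g := by
  have hc : hfin.toFinset.card = g := by rw [← Set.ncard_eq_toFinset_card _ hfin, hcard]
  obtain ⟨k, hk, rfl⟩ := Nat.exists_lt_card_finite_nth_eq (p := fun n => n ∉ H) hfin hn
  have hk' : k < g := hc ▸ hk
  refine Nat.nth_le_nth' (by omega) fun _ => ?_
  change g - 1 < hfin.toFinset.card
  omega

theorem gap_notMem {H : Set ℕ} {g i : ℕ} (hfin : Hᶜ.Finite) (hcard : Hᶜ.ncard = g)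
    (hi : 1 ≤ i) (hig : i ≤ g) : gap H i ∉ H := by
  refine Nat.nth_mem (p := fun n => n ∉ H) (i - 1) fun _ => ?_
  change i - 1 < hfin.toFinset.card
  rw [← Set.ncard_eq_toFinset_card _ hfin]
  omega

theorem gap_lt_gap {H : Set ℕ} {g i j : ℕ} (hfin : Hᶜ.Finite) (hcard : Hᶜ.ncard = g)
    (hi : 1 ≤ i) (hij : i < j) (hjg : j ≤ g) : gap H i < gap H j := by
  refine Nat.nth_lt_nth' (by omega) fun _ => ?_
  change j - 1 < hfin.toFinset.card
  rw [← Set.ncard_eq_toFinset_card _ hfin]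
  omega

/-- In a symmetric numerical semigroup, the reflection of a gap in the Frobenius number
is not a gap. -/
theorem sub_mem_of_symmetric {H : Set ℕ} {g n : ℕ} (hg : 0 < g)
    (hH : IsNumericalSemigroupOfGenus H g) (hsym : gap H g = 2 * g - 1) (hn : n ∉ H) :
    2 * g - 1 - n ∈ H := by
  classical
  obtain ⟨-, hadd, hfin, hcard⟩ := hH
  have hF : 2 * g - 1 ∉ H := hsym ▸ gap_notMem hfin hcard hg le_rfl
  have hle {m : ℕ} (hm : m ∉ H) : m ≤ 2 * g - 1 := hsym ▸ le_gap_genus hfin hcard hm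
  have hgaps : (Finset.range (2 * g)).filter (· ∉ H) = hfin.toFinset := by
    ext m
    simp only [Finset.mem_filter, Finset.mem_range, Set.Finite.mem_toFinset, Set.mem_compl_iff]
    exact ⟨And.right, fun hm => ⟨by have := hle hm; omega, hm⟩⟩
  have hgcard : hfin.toFinset.card = g := by rw [← Set.ncard_eq_toFinset_card _ hfin, hcard]
  have hmem : ((Finset.range (2 * g)).filter (· ∈ H)).card = g := by
    have := Finset.card_filter_add_card_filter_not (s := Finset.range (2 * g)) (· ∈ H)
    rw [hgaps, hgcard, Finset.card_range] at this
    omega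
  have himage : ((Finset.range (2 * g)).filter (· ∈ H)).image (2 * g - 1 - ·) =
      hfin.toFinset := by
    refine Finset.eq_of_subset_of_card_le ?_ ?_
    · simp only [Finset.image_subset_iff, Finset.mem_filter, Finset.mem_range,
        Set.Finite.mem_toFinset, Set.mem_compl_iff]
      rintro x ⟨hx, hxH⟩ hxF
      have := hadd _ hxH _ hxF
      rw [Nat.add_sub_cancel' (by omega)] at this
      exact hF this
    · rw [Finset.card_image_of_injOn, hmem, hgcard]
      intro x hx y hy hxy
      simp only [Finset.coe_filter, Finset.mem_range, Set.mem_ofPred_eq] at hx hy hxy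
      omega
  have hn' : n ∈ hfin.toFinset := by simpa using hn
  rw [← himage] at hn'
  simp only [Finset.mem_image, Finset.mem_filter, Finset.mem_range] at hn'
  obtain ⟨x, ⟨hx, hxH⟩, rfl⟩ := hn'
  rwa [Nat.sub_sub_self (by omega)]

/-- **Corollary.** If `H` is a sparse numerical semigroup of genus `g > 1` that is
symmetric (`ℓ_g = 2g - 1`), then `H` is the hyperelliptic semigroup `⟨2, 2g+1⟩`,
i.e. `H = {2k : k ∈ ℕ} ∪ {m : m ≥ 2g}`. -/
theorem symmetric_sparse (H : Set ℕ) (g : ℕ) (hg : 1 < g)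
    (hH : IsNumericalSemigroupOfGenus H g) (hs : IsSparse H g)
    (hsym : gap H g = 2 * g - 1) :
    H = {n : ℕ | ∃ k, n = 2 * k} ∪ {m : ℕ | 2 * g ≤ m} := by
  obtain ⟨h0, hadd, hfin, hcard⟩ := id hH
  have hF : 2 * g - 1 ∉ H := hsym ▸ gap_notMem hfin hcard hg.le le_rfl
  have hmul {a : ℕ} (ha : a ∈ H) (k : ℕ) : a * k ∈ H := by
    induction k with
    | zero => exact h0
    | succ k ih => exact hadd _ ih _ ha
  have h1 : 1 ∉ H := fun h => hF (by simpa using hmul h (2 * g - 1))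
  have h2 : 2 ∈ H := by
    by_contra h2
    have hF1 := sub_mem_of_symmetric (by omega) hH hsym h1
    have hF2 := sub_mem_of_symmetric (by omega) hH hsym h2
    have hprev := gap_notMem hfin hcard (i := g - 1) (by omega) (by omega)
    have hlt := gap_lt_gap hfin hcard (i := g - 1) (j := g) (by omega) (by omega) le_rfl
    have hleap := hs (g - 1) (by omega) le_rfl
    rw [Nat.sub_add_cancel hg.le] at hleap
    obtain h | h : gap H (g - 1) = 2 * g - 1 - 1 ∨ gap H (g - 1) = 2 * g - 1 - 2 := by omega
    · exact hprev (h ▸ hF1)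
    · exact hprev (h ▸ hF2)
  ext n
  simp only [Set.mem_union, Set.mem_ofPred_eq]
  refine ⟨fun hn => ?_, ?_⟩
  · by_contra! h
    obtain ⟨hodd, hlt⟩ := h
    have := hodd (n / 2)
    refine hF ?_
    convert hadd _ hn _ (hmul h2 ((2 * g - 1 - n) / 2)) using 1
    omega
  · rintro (⟨k, rfl⟩ | hn)
    · exact hmul h2 k
    · by_contra h
      have := le_gap_genus hfin hcard h
      omega
end

section
/- Let H be a sparse numerical semigroup of genus g ≥ 5 with Frobenius number ℓ_g = 2g - 5. Then H is one of the following ten semigroups: (1) {0, 3, 6, 9} ∪ {n ≥ 12} (genus 8); (2) {0, 3, 6, 9, 12} ∪ {n ≥ 14} (genus 9); (3) {2k : k ∈ ℕ, k ∉ {1,3}, 2k ≤ 2g - 6} ∪ {n ≥ 2g - 4}, with g ≥ 6; (4) {0, 5, 7} ∪ {n ≥ 10}; (5) {0, 5, 7, 10} ∪ {n ≥ 12}; (6) {0, 5, 7, 10, 12} ∪ {n ≥ 14}; (7) {0, 5} ∪ {n ≥ 8}; (8) {0, 5, 8} ∪ {n ≥ 10}; (9) {0, 5, 8, 10} ∪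 {n ≥ 12}; (10) {2k : k ∈ ℕ, k ∉ {1,2}, 2k ≤ 2g - 6} ∪ {n ≥ 2g - 4}, with g ≥ 5. -/
/-- The predicate that `k` and `k + 1` are both gaps of `H`. -/
def IsDoubleGap (H : Set ℕ) (k : ℕ) : Prop := k ∉ H ∧ k + 1 ∉ H

theorem card_toFinset_gaps {H : Set ℕ} {g : ℕ} (hcard : Hᶜ.ncard = g)
    (hf : (Set.ofPred fun n => n ∉ H).Finite) : hf.toFinset.card = g := by
  rw [← hcard, ← Set.ncard_eq_toFinset_card _ hf]
  rfl

theorem gap_not_mem_and_lt_mem {H : Set ℕ} {g : ℕ} (hg : 1 ≤ g) (hfin : Hᶜ.Finite)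
    (hcard : Hᶜ.ncard = g) : gap H g ∉ H ∧ ∀ n, gap H g < n → n ∈ H := by
  classical
  have hlt : ∀ hf : (Set.ofPred fun n => n ∉ H).Finite, g - 1 < hf.toFinset.card := fun hf => by
    rw [card_toFinset_gaps hcard]
    omega
  refine ⟨Nat.nth_mem (p := fun n => n ∉ H) (g - 1) hlt, fun n hn => ?_⟩
  by_contra hnH
  have h1 : Nat.count (fun n => n ∉ H) (gap H g) = g - 1 :=
    Nat.count_nth (p := fun n => n ∉ H) hlt
  have h2 : gap H g ∉ H := Nat.nth_mem (p := fun n => n ∉ H) (g - 1) hlt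
  have h3 := Nat.count_strict_mono (p := fun n => n ∉ H) h2 hn
  have h4 := Nat.count_lt_card (p := fun n => n ∉ H) hfin hnH
  rw [card_toFinset_gaps hcard] at h4
  omega

theorem IsSparse.succ_not_mem {H : Set ℕ} {g : ℕ} (hg : 1 ≤ g)
    (hH : IsNumericalSemigroupOfGenus H g) (hs : IsSparse H g) {n : ℕ} (hn : n < gap H g)
    (hnH : n ∈ H) : n + 1 ∉ H := by
  classical
  obtain ⟨h0, hadd, hfin, hcard⟩ := hH
  obtain ⟨hF, -⟩ := gap_not_mem_and_lt_mem hg hfin hcard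
  intro hn1
  have h1 : 1 ∉ H := by
    intro h1
    have : ∀ k, k ∈ H := by
      intro k
      induction k with
      | zero => exact h0
      | succ k ih => exact hadd _ ih _ h1
    exact hF (this _)
  have hn2 : 2 ≤ n := by
    rcases n with _ | _ | n
    · exact absurd hn1 h1
    · exact absurd hnH h1
    · omega
  set i := Nat.count (fun n => n ∉ H) n with hi
  have hi1 : 1 ≤ i :=
    (Nat.zero_le _).trans_lt (Nat.count_strict_mono (p := fun n => n ∉ H) h1 hn2)
  have hF1 : Nat.count (fun n => n ∉ H) (gap H g) = g - 1 :=
    Nat.count_nth (p := fun n => n ∉ H) fun _ => by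
      rw [card_toFinset_gaps hcard]
      omega
  have hig : i ≤ g - 1 := hF1 ▸ Nat.count_monotone _ hn.le
  have hprev : gap H i < n :=
    Nat.nth_lt_of_lt_count (p := fun n => n ∉ H) (by omega)
  have hnext : n ≤ gap H (i + 1) :=
    Nat.le_nth_count' (p := fun n => n ∉ H) ⟨gap H g, hF, hn.le⟩
  have hmem : gap H (i + 1) ∉ H :=
    Nat.nth_mem (p := fun n => n ∉ H) i fun _ => by
      rw [card_toFinset_gaps hcard]
      omega
  have hd := hs i hi1 hig
  have e1 : gap H (i + 1) ≠ n := fun h => hmem (h ▸ hnH)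
  have e2 : gap H (i + 1) ≠ n + 1 := fun h => hmem (h ▸ hn1)
  omega

open scoped Classical in
theorem two_mul_count_gaps {H : Set ℕ} {F : ℕ} (h0 : 0 ∈ H)
    (hsp : ∀ n, n < F → n ∈ H → n + 1 ∉ H) (n : ℕ) (hn : n ≤ F) :
    2 * Nat.count (fun n => n ∉ H) (n + 1) + (if n ∈ H then 1 else 0) =
      n + 1 + Nat.count (IsDoubleGap H) n := by
  induction n with
  | zero => simp [Nat.count_succ, h0]
  | succ n ih =>
    have := ih (by omega)
    have hs := hsp n (by omega)
    rw [Nat.count_succ, Nat.count_succ (IsDoubleGap H)]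
    unfold IsDoubleGap at *
    by_cases h1 : n ∈ H <;> by_cases h2 : n + 1 ∈ H <;> simp_all <;> omega

open scoped Classical in
theorem count_isDoubleGap_eq_four {H : Set ℕ} {g : ℕ} (hg : 5 ≤ g)
    (hH : IsNumericalSemigroupOfGenus H g) (hs : IsSparse H g)
    (hF : gap H g = 2 * g - 5) : Nat.count (IsDoubleGap H) (2 * g - 5) = 4 := by
  have hFH := (gap_not_mem_and_lt_mem (by omega) hH.2.2.1 hH.2.2.2).1
  have hF1 : Nat.count (fun n => n ∉ H) (gap H g) = g - 1 :=
    Nat.count_nth (p := fun n => n ∉ H) fun _ => by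
      rw [card_toFinset_gaps hH.2.2.2]
      omega
  have h := two_mul_count_gaps hH.1 (fun n hn => hs.succ_not_mem (by omega) hH hn) _ le_rfl
  rw [Nat.count_succ, hF1, if_pos hFH, if_neg hFH, hF] at h
  omega

open scoped Classical in
theorem count_eq_of_forall_not {p : ℕ → Prop} {a n : ℕ} (han : a ≤ n)
    (h : ∀ k, a ≤ k → k < n → ¬ p k) : Nat.count p n = Nat.count p a := by
  induction n, han using Nat.le_induction with
  | base => rfl
  | succ n hn ih =>
    rw [Nat.count_succ, if_neg (h n hn (by omega)), ih fun k h1 h2 => h k h1 (by omega), add_zero]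

open scoped Classical in
/-- Once all the double gaps below `F` have been used up, `H` alternates up to `F`. -/
theorem mem_iff_even_of_count_eq {H : Set ℕ} {F a : ℕ}
    (hsp : ∀ n, n < F → n ∈ H → n + 1 ∉ H)
    (hc : Nat.count (IsDoubleGap H) F = Nat.count (IsDoubleGap H) a)
    (ha : a ∈ H) (ha2 : a % 2 = 0) (n : ℕ) (han : a ≤ n) (hn : n ≤ F) :
    n ∈ H ↔ n % 2 = 0 := by
  induction n, han using Nat.le_induction with
  | base => simp [ha, ha2]
  | succ n han ih =>
    have ih := ih (by omega)
    have hs := hsp n (by omega)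
    have hq : ¬ IsDoubleGap H n := by
      intro hq
      have h1 := Nat.count_strict_mono hq (show n < F by omega)
      have h2 := Nat.count_monotone (IsDoubleGap H) han
      omega
    unfold IsDoubleGap at hq
    by_cases h1 : n ∈ H
    · have := ih.1 h1
      exact ⟨fun h => absurd h (hs h1), fun h => by omega⟩
    · have h2 : n + 1 ∈ H := by tauto
      have : ¬ n % 2 = 0 := fun h => h1 (ih.2 h)
      exact ⟨fun _ => by omega, fun _ => h2⟩

theorem mul_mem_of_add_mem {H : Set ℕ} (h0 : 0 ∈ H) (hadd : ∀ a ∈ H, ∀ b ∈ H, a + b ∈ H)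
    {m : ℕ} (hm : m ∈ H) (k : ℕ) : m * k ∈ H := by
  induction k with
  | zero => exact h0
  | succ k ih => exact hadd _ ih _ hm

open scoped Classical in
theorem eq_of_three_mem {H : Set ℕ} {F : ℕ} (h0 : 0 ∈ H)
    (hadd : ∀ a ∈ H, ∀ b ∈ H, a + b ∈ H) (hF : F ∉ H) (hgt : ∀ n, F < n → n ∈ H)
    (hodd : F % 2 = 1) (hsp : ∀ n, n < F → n ∈ H → n + 1 ∉ H)
    (hc : Nat.count (IsDoubleGap H) F = 4) (h3 : 3 ∈ H) :
    H = ({0, 3, 6, 9} : Set ℕ) ∪ {n : ℕ | 12 ≤ n} ∨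
    H = ({0, 3, 6, 9, 12} : Set ℕ) ∪ {n : ℕ | 14 ≤ n} := by
  have hmem : ∀ n, n ≤ F → (n ∈ H ↔ n % 3 = 0) := by
    intro n hn
    have hmul : ∀ n, n % 3 = 0 → n ∈ H := fun n h => by
      have := mul_mem_of_add_mem h0 hadd h3 (n / 3)
      rwa [show 3 * (n / 3) = n by omega] at this
    refine ⟨fun h => ?_, hmul n⟩
    have hne : n ≠ F := fun e => hF (e ▸ h)
    by_contra h'
    rcases (by omega : n % 3 = 1 ∨ n % 3 = 2) with h1 | h1
    · refine hsp (n - 1) (by omega) (hmul _ (by omega)) ?_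
      rwa [show n - 1 + 1 = n by omega]
    · exact hsp n (by omega) h (hmul _ (by omega))
  have hcount : ∀ n, n ≤ F → Nat.count (IsDoubleGap H) n = Nat.count (fun k => k % 3 = 1) n := by
    intro n hn
    induction n with
    | zero => simp
    | succ n ih =>
      rw [Nat.count_succ, Nat.count_succ, ih (by omega)]
      congr 1
      have : IsDoubleGap H n ↔ n % 3 = 1 := by
        unfold IsDoubleGap
        rw [hmem n (by omega), hmem (n + 1) hn]
        omega
      simp [this]
  rw [hcount F le_rfl] at hc
  have hF14 : F < 14 := by
    by_contra h
    have h1 := Nat.count_monotone (fun k => k % 3 = 1) (show 14 ≤ F by omega)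
    simp [Nat.count_succ] at h1 hc
    omega
  have hF11 : 11 ≤ F := by
    by_contra h
    have h1 := Nat.count_monotone (fun k => k % 3 = 1) (show F ≤ 10 by omega)
    simp [Nat.count_succ] at h1 hc
    omega
  have hmem' : ∀ n, n ∈ H ↔ n % 3 = 0 ∨ F < n := fun n => by
    rcases le_or_gt n F with h | h
    · rw [hmem n h]; omega
    · simp [hgt n h, h]
  rcases (by omega : F = 11 ∨ F = 13) with rfl | rfl
  · left
    ext n
    rw [hmem']
    simp only [Set.mem_union, Set.mem_insert_iff, Set.mem_singleton_iff, Set.mem_ofPred_eq]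
    omega
  · right
    ext n
    rw [hmem']
    simp only [Set.mem_union, Set.mem_insert_iff, Set.mem_singleton_iff, Set.mem_ofPred_eq]
    omega

open scoped Classical in
theorem eq_of_four_mem {H : Set ℕ} {F : ℕ} (h0 : 0 ∈ H)
    (hadd : ∀ a ∈ H, ∀ b ∈ H, a + b ∈ H) (hF : F ∉ H) (hgt : ∀ n, F < n → n ∈ H)
    (hF5 : 5 ≤ F) (hodd : F % 2 = 1) (hsp : ∀ n, n < F → n ∈ H → n + 1 ∉ H)
    (hc : Nat.count (IsDoubleGap H) F = 4) (h1 : 1 ∉ H) (h2 : 2 ∉ H) (h3 : 3 ∉ H)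
    (h4 : 4 ∈ H) :
    7 ≤ F ∧ H = {n : ℕ | ∃ k, k ≠ 1 ∧ k ≠ 3 ∧ n = 2 * k ∧ 2 * k ≤ F - 1} ∪
      {n : ℕ | F + 1 ≤ n} := by
  have h5 : 5 ∉ H := hsp 4 (by omega) h4
  have c4 : Nat.count (IsDoubleGap H) 4 = 2 := by
    simp [Nat.count_succ, IsDoubleGap, *]
  have h6 : 6 ∉ H := by
    intro h6
    have heven : ∀ k, 4 ≤ k → k % 2 = 0 → k ∈ H := by
      intro k hk hk2
      rcases (by omega : k % 4 = 0 ∨ k % 4 = 2) with h | h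
      · have := mul_mem_of_add_mem h0 hadd h4 (k / 4)
        rwa [show 4 * (k / 4) = k by omega] at this
      · have := hadd _ (mul_mem_of_add_mem h0 hadd h4 (k / 4 - 1)) _ h6
        rwa [show 4 * (k / 4 - 1) + 6 = k by omega] at this
    have := count_eq_of_forall_not (p := IsDoubleGap H) (show 4 ≤ F by omega) fun k hk _ hq => by
      rcases Nat.mod_two_eq_zero_or_one k with h | h
      · exact hq.1 (heven k hk h)
      · exact hq.2 (heven (k + 1) (by omega) (by omega))
    omega
  have hF7 : 7 ≤ F := by
    by_contra h
    exact h6 (hgt 6 (by omega))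
  have h8 : 8 ∈ H := hadd 4 h4 4 h4
  have h7 : 7 ∉ H := by
    rcases hF7.eq_or_lt with h | h
    · exact h ▸ hF
    · exact fun h7 => hsp 7 h h7 h8
  have c8 : Nat.count (IsDoubleGap H) 8 = 4 := by
    simp [Nat.count_succ, IsDoubleGap, *]
  have halt := mem_iff_even_of_count_eq hsp (hc.trans c8.symm) h8 rfl
  refine ⟨hF7, ?_⟩
  ext n
  simp only [Set.mem_union, Set.mem_ofPred_eq]
  rcases lt_or_ge F n with h | h
  · simp [hgt n h, Nat.succ_le_of_lt h]
  · rcases le_or_gt 8 n with h' | h'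
    · rw [halt n h' h]
      constructor
      · exact fun e => Or.inl ⟨n / 2, by omega⟩
      · rintro (⟨k, hk⟩ | hk) <;> omega
    · have : n ∈ H ↔ n = 0 ∨ n = 4 := by interval_cases n <;> simp [*]
      rw [this]
      constructor
      · exact fun e => Or.inl ⟨n / 2, by omega⟩
      · rintro (⟨k, hk⟩ | hk) <;> omega

open scoped Classical in
theorem eq_of_five_mem {H : Set ℕ} {F : ℕ} (h0 : 0 ∈ H)
    (hadd : ∀ a ∈ H, ∀ b ∈ H, a + b ∈ H) (hF : F ∉ H) (hgt : ∀ n, F < n → n ∈ H)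
    (hF5 : 5 ≤ F) (hodd : F % 2 = 1) (hsp : ∀ n, n < F → n ∈ H → n + 1 ∉ H)
    (hc : Nat.count (IsDoubleGap H) F = 4) (h1 : 1 ∉ H) (h2 : 2 ∉ H) (h3 : 3 ∉ H)
    (h4 : 4 ∉ H) (h5 : 5 ∈ H) :
    H = ({0, 5, 7} : Set ℕ) ∪ {n : ℕ | 10 ≤ n} ∨
    H = ({0, 5, 7, 10} : Set ℕ) ∪ {n : ℕ | 12 ≤ n} ∨
    H = ({0, 5, 7, 10, 12} : Set ℕ) ∪ {n : ℕ | 14 ≤ n} ∨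
    H = ({0, 5} : Set ℕ) ∪ {n : ℕ | 8 ≤ n} ∨
    H = ({0, 5, 8} : Set ℕ) ∪ {n : ℕ | 10 ≤ n} ∨
    H = ({0, 5, 8, 10} : Set ℕ) ∪ {n : ℕ | 12 ≤ n} := by
  have hne : ∀ n ∈ H, n ≠ F := fun n hn e => hF (e ▸ hn)
  have hF7 : 7 ≤ F := by have := hne 5 h5; omega
  have h6 : 6 ∉ H := hsp 5 (by omega) h5
  have h10 : 10 ∈ H := hadd 5 h5 5 h5
  by_cases h7 : 7 ∈ H
  · have hF9 : 9 ≤ F := by have := hne 7 h7; omega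
    have h8 : 8 ∉ H := hsp 7 (by omega) h7
    have h9 : 9 ∉ H := by
      rcases hF9.eq_or_lt with h | h
      · exact h ▸ hF
      · exact fun h9 => hsp 9 h h9 h10
    have c10 : Nat.count (IsDoubleGap H) 10 = 4 := by
      simp [Nat.count_succ, IsDoubleGap, *]
    have halt := mem_iff_even_of_count_eq hsp (hc.trans c10.symm) h10 rfl
    have hF15 : F < 15 := by
      by_contra h
      have := (halt 15 (by omega) (by omega)).1 (hadd 5 h5 10 h10)
      omega
    have hmem : ∀ n, n ∈ H ↔ n = 0 ∨ n = 5 ∨ n = 7 ∨ (10 ≤ n ∧ n % 2 = 0) ∨ F < n := by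
      intro n
      rcases lt_or_ge F n with h | h
      · simp [hgt n h, h]
      · rcases le_or_gt 10 n with h' | h'
        · rw [halt n h' h]; omega
        · have : n ∈ H ↔ n = 0 ∨ n = 5 ∨ n = 7 := by interval_cases n <;> simp [*]
          rw [this]; omega
    rcases (by omega : F = 9 ∨ F = 11 ∨ F = 13) with rfl | rfl | rfl
    · left; ext n; rw [hmem]
      simp only [Set.mem_union, Set.mem_insert_iff, Set.mem_singleton_iff, Set.mem_ofPred_eq]
      omega
    · right; left; ext n; rw [hmem]
      simp only [Set.mem_union, Set.mem_insert_iff, Set.mem_singleton_iff, Set.mem_ofPred_eq]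
      omega
    · right; right; left; ext n; rw [hmem]
      simp only [Set.mem_union, Set.mem_insert_iff, Set.mem_singleton_iff, Set.mem_ofPred_eq]
      omega
  · have c7 : Nat.count (IsDoubleGap H) 7 = 4 := by
      simp [Nat.count_succ, IsDoubleGap, *]
    have h8 : 8 ∈ H := by
      by_contra h8
      have hF9 : 8 ≤ F := by
        by_contra h
        exact h8 (hgt 8 (by omega))
      have := Nat.count_strict_mono (p := IsDoubleGap H) ⟨h7, h8⟩ (show 7 < F by omega)
      omega
    have c8 : Nat.count (IsDoubleGap H) 8 = 4 := by
      rw [Nat.count_succ, c7, if_neg fun h => h.2 h8]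
    have halt := mem_iff_even_of_count_eq hsp (hc.trans c8.symm) h8 rfl
    have hF13 : F < 13 := by
      by_contra h
      have := (halt 13 (by omega) (by omega)).1 (hadd 5 h5 8 h8)
      omega
    have hmem : ∀ n, n ∈ H ↔ n = 0 ∨ n = 5 ∨ (8 ≤ n ∧ n % 2 = 0) ∨ F < n := by
      intro n
      rcases lt_or_ge F n with h | h
      · simp [hgt n h, h]
      · rcases le_or_gt 8 n with h' | h'
        · rw [halt n h' h]; omega
        · have : n ∈ H ↔ n = 0 ∨ n = 5 ∨ n = 8 := by interval_cases n <;> simp [*]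
          rw [this]; omega
    rcases (by omega : F = 7 ∨ F = 9 ∨ F = 11) with rfl | rfl | rfl
    · right; right; right; left; ext n; rw [hmem]
      simp only [Set.mem_union, Set.mem_insert_iff, Set.mem_singleton_iff, Set.mem_ofPred_eq]
      omega
    · right; right; right; right; left; ext n; rw [hmem]
      simp only [Set.mem_union, Set.mem_insert_iff, Set.mem_singleton_iff, Set.mem_ofPred_eq]
      omega
    · right; right; right; right; right; ext n; rw [hmem]
      simp only [Set.mem_union, Set.mem_insert_iff, Set.mem_singleton_iff, Set.mem_ofPred_eq]
      omega

open scoped Classical in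
theorem eq_of_not_mem_of_le_five {H : Set ℕ} {F : ℕ} (h0 : 0 ∈ H)
    (hgt : ∀ n, F < n → n ∈ H) (hodd : F % 2 = 1) (hsp : ∀ n, n < F → n ∈ H → n + 1 ∉ H)
    (hc : Nat.count (IsDoubleGap H) F = 4) (h1 : 1 ∉ H) (h2 : 2 ∉ H) (h3 : 3 ∉ H)
    (h4 : 4 ∉ H) (h5 : 5 ∉ H) :
    H = {n : ℕ | ∃ k, k ≠ 1 ∧ k ≠ 2 ∧ n = 2 * k ∧ 2 * k ≤ F - 1} ∪
      {n : ℕ | F + 1 ≤ n} := by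
  have c5 : Nat.count (IsDoubleGap H) 5 = 4 := by
    simp [Nat.count_succ, IsDoubleGap, *]
  have h6 : 6 ∈ H := by
    by_contra h6
    have hF6 : 6 ≤ F := by
      by_contra h
      exact h6 (hgt 6 (by omega))
    have := Nat.count_strict_mono (p := IsDoubleGap H) ⟨h5, h6⟩ (show 5 < F by omega)
    omega
  have c6 : Nat.count (IsDoubleGap H) 6 = 4 := by
    rw [Nat.count_succ, c5, if_neg fun h => h.2 h6]
  have halt := mem_iff_even_of_count_eq hsp (hc.trans c6.symm) h6 rfl
  ext n
  simp only [Set.mem_union, Set.mem_ofPred_eq]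
  rcases lt_or_ge F n with h | h
  · simp [hgt n h, Nat.succ_le_of_lt h]
  · rcases le_or_gt 6 n with h' | h'
    · rw [halt n h' h]
      constructor
      · exact fun e => Or.inl ⟨n / 2, by omega⟩
      · rintro (⟨k, hk⟩ | hk) <;> omega
    · have : n ∈ H ↔ n = 0 := by interval_cases n <;> simp [*]
      rw [this]
      constructor
      · exact fun e => Or.inl ⟨n / 2, by omega⟩
      · rintro (⟨k, hk⟩ | hk) <;> omega

/-- **Theorem.** Let `H` be a sparse numerical semigroup of genus `g ≥ 5` with
Frobenius number `ℓ_g = 2g - 5`. Then `H` is one of the following ten semigroups: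
(1) `{0,3,6,9} ∪ {n ≥ 12}`;
(2) `{0,3,6,9,12} ∪ {n ≥ 14}`;
(3) `{2k : k ∉ {1,3}, 2k ≤ 2g-6} ∪ {n ≥ 2g-4}` (with `g ≥ 6`);
(4) `{0,5,7} ∪ {n ≥ 10}`;
(5) `{0,5,7,10} ∪ {n ≥ 12}`;
(6) `{0,5,7,10,12} ∪ {n ≥ 14}`;
(7) `{0,5} ∪ {n ≥ 8}`;
(8) `{0,5,8} ∪ {n ≥ 10}`;
(9) `{0,5,8,10} ∪ {n ≥ 12}`;
(10) `{2k : k ∉ {1,2}, 2k ≤ 2g-6} ∪ {n ≥ 2g-4}` (with `g ≥ 5`). -/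
theorem charact_frobenius_2g_sub_5 (H : Set ℕ) (g : ℕ) (hg : 5 ≤ g)
    (hH : IsNumericalSemigroupOfGenus H g) (hs : IsSparse H g)
    (hF : gap H g = 2 * g - 5) :
    H = ({0, 3, 6, 9} : Set ℕ) ∪ {n : ℕ | 12 ≤ n} ∨
    H = ({0, 3, 6, 9, 12} : Set ℕ) ∪ {n : ℕ | 14 ≤ n} ∨
    (6 ≤ g ∧
      H = {n : ℕ | ∃ k, k ≠ 1 ∧ k ≠ 3 ∧ n = 2 * k ∧ 2 * k ≤ 2 * g - 6} ∪
          {n : ℕ | 2 * g - 4 ≤ n}) ∨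
    H = ({0, 5, 7} : Set ℕ) ∪ {n : ℕ | 10 ≤ n} ∨
    H = ({0, 5, 7, 10} : Set ℕ) ∪ {n : ℕ | 12 ≤ n} ∨
    H = ({0, 5, 7, 10, 12} : Set ℕ) ∪ {n : ℕ | 14 ≤ n} ∨
    H = ({0, 5} : Set ℕ) ∪ {n : ℕ | 8 ≤ n} ∨
    H = ({0, 5, 8} : Set ℕ) ∪ {n : ℕ | 10 ≤ n} ∨
    H = ({0, 5, 8, 10} : Set ℕ) ∪ {n : ℕ | 12 ≤ n} ∨
    (5 ≤ g ∧
      H = {n : ℕ | ∃ k, k ≠ 1 ∧ k ≠ 2 ∧ n = 2 * k ∧ 2 * k ≤ 2 * g - 6} ∪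
          {n : ℕ | 2 * g - 4 ≤ n}) := by
  classical
  have hc := count_isDoubleGap_eq_four hg hH hs hF
  have hsp : ∀ n, n < 2 * g - 5 → n ∈ H → n + 1 ∉ H := fun n hn =>
    hs.succ_not_mem (by omega) hH (by omega)
  obtain ⟨h0, hadd, hfin, hcard⟩ := hH
  obtain ⟨hFH, hgt⟩ := gap_not_mem_and_lt_mem (by omega) hfin hcard
  rw [hF] at hFH hgt
  have hF5 : 5 ≤ 2 * g - 5 := by omega
  have hodd : (2 * g - 5) % 2 = 1 := by omega
  have e1 : 2 * g - 5 - 1 = 2 * g - 6 := by omega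
  have e2 : 2 * g - 5 + 1 = 2 * g - 4 := by omega
  have h1 : 1 ∉ H := hsp 0 (by omega) h0
  have h2 : 2 ∉ H := by
    intro h2
    have heven : ∀ k, k % 2 = 0 → k ∈ H := fun k hk => by
      have := mul_mem_of_add_mem h0 hadd h2 (k / 2)
      rwa [show 2 * (k / 2) = k by omega] at this
    have := count_eq_of_forall_not (p := IsDoubleGap H) (Nat.zero_le (2 * g - 5))
      fun k _ _ hq => by
        rcases Nat.mod_two_eq_zero_or_one k with h | h
        · exact hq.1 (heven k h)
        · exact hq.2 (heven (k + 1) (by omega))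
    rw [Nat.count_zero] at this
    omega
  by_cases h3 : 3 ∈ H
  · have := eq_of_three_mem h0 hadd hFH hgt hodd hsp hc h3
    tauto
  by_cases h4 : 4 ∈ H
  · obtain ⟨h7, h⟩ := eq_of_four_mem h0 hadd hFH hgt hF5 hodd hsp hc h1 h2 h3 h4
    rw [e1, e2] at h
    exact Or.inr (Or.inr (Or.inl ⟨by omega, h⟩))
  by_cases h5 : 5 ∈ H
  · have := eq_of_five_mem h0 hadd hFH hgt hF5 hodd hsp hc h1 h2 h3 h4 h5
    tauto
  have h := eq_of_not_mem_of_le_five h0 hgt hodd hsp hc h1 h2 h3 h4 h5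
  rw [e1, e2] at h
  tauto
end

section
/- Let H be a sparse numerical semigroup of genus g > 1 whose Frobenius number is even, ℓ_g = 2g - 2r. Then g ≤ 4r - 1. -/
/-- In an additively closed set containing `0`, multiples of elements are elements. -/
lemma mul_mem_of_add_closed {H : Set ℕ} (h0 : 0 ∈ H) (hadd : ∀ a ∈ H, ∀ b ∈ H, a + b ∈ H)
    {a : ℕ} (ha : a ∈ H) (n : ℕ) : n * a ∈ H := by
  induction n with
  | zero => simpa using h0
  | succ k ih => rw [Nat.succ_mul]; exact hadd _ ih _ ha

open Finset in
open scoped Classical in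
/-- If an additively closed set misses the even number `F` and has no two consecutive
elements below `F`, then it has at most `(F - 1) / 3` elements in `[1, F]`. -/
lemma three_mul_card_lt_of_even {H : Set ℕ} (h0 : 0 ∈ H)
    (hadd : ∀ a ∈ H, ∀ b ∈ H, a + b ∈ H) {F : ℕ} (hF0 : 0 < F) (hFe : F % 2 = 0) (hF : F ∉ H)
    (hsp : ∀ x < F, x ∈ H → x + 1 ∉ H) :
    3 * #{x ∈ Icc 1 F | x ∈ H} + 1 ≤ F := by
  have h1 : 1 ∉ H := fun h => hF (by simpa using mul_mem_of_add_closed h0 hadd h F)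
  have h2 : 2 ∉ H := fun h => hF (by
    have := mul_mem_of_add_closed h0 hadd h (F / 2)
    rwa [show F / 2 * 2 = F by omega] at this)
  set A : Finset ℕ := {x ∈ Icc 1 F | x ∈ H} with hA
  set G : Finset ℕ := {x ∈ Icc 2 F | x ∉ H ∧ x - 1 ∉ H} with hG
  have memA : ∀ x, x ∈ A ↔ (1 ≤ x ∧ x ≤ F) ∧ x ∈ H := fun x => by simp [hA]
  have memG : ∀ x, x ∈ G ↔ (2 ≤ x ∧ x ≤ F) ∧ x ∉ H ∧ x - 1 ∉ H := fun x => by simp [hG]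
  have hcount : #G + 2 * #A + 1 ≤ F := by
    have hd1 : Disjoint A (A.image (· + 1)) := by
      rw [disjoint_left]
      intro x hx hx'
      obtain ⟨y, hy, rfl⟩ := mem_image.1 hx'
      rw [memA] at hx hy
      exact hsp y (by omega) hy.2 hx.2
    have hd2 : Disjoint G (A ∪ A.image (· + 1)) := by
      rw [disjoint_left]
      intro x hx hx'
      rw [memG] at hx
      rcases mem_union.1 hx' with h | h
      · exact hx.2.1 ((memA x).1 h).2
      · obtain ⟨y, hy, rfl⟩ := mem_image.1 h
        exact hx.2.2 (by simpa using ((memA y).1 hy).2)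
    have hsub : G ∪ (A ∪ A.image (· + 1)) ⊆ Icc 2 F := by
      intro x hx
      rw [mem_Icc]
      rcases mem_union.1 hx with h | h
      · exact ((memG x).1 h).1
      rcases mem_union.1 h with h | h
      · rw [memA] at h
        have : x ≠ 1 := by rintro rfl; exact h1 h.2
        omega
      · obtain ⟨y, hy, rfl⟩ := mem_image.1 h
        rw [memA] at hy
        have : y ≠ F := by rintro rfl; exact hF hy.2
        constructor <;> omega
    have := card_le_card hsub
    rw [card_union_of_disjoint hd2, card_union_of_disjoint hd1,
      card_image_of_injective _ (add_left_injective 1), Nat.card_Icc] at this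
    omega
  suffices #A ≤ #G by omega
  have hne : G.Nonempty := ⟨2, (memG 2).2 ⟨⟨le_rfl, by omega⟩, h2, h1⟩⟩
  obtain ⟨c, hcG, hmax⟩ : ∃ c ∈ G, ∀ x ∈ G, x ≤ c := ⟨G.max' hne, G.max'_mem hne, G.le_max'⟩
  obtain ⟨⟨hc2, hcF⟩, hcH, hcH'⟩ := (memG c).1 hcG
  have hodd : ∀ j, c + 2 * j ∉ H → c + 2 * j + 1 ≤ F → c + 2 * j + 1 ∈ H := by
    intro j hj hle
    by_contra hn
    have := hmax _ ((memG (c + 2 * j + 1)).2 ⟨⟨by omega, hle⟩, hn, by simpa using hj⟩)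
    omega
  have heven : ∀ j, c + 2 * j ≤ F → c + 2 * j ∉ H := by
    intro j
    induction j with
    | zero => intro _; simpa using hcH
    | succ j ih =>
      intro hle
      exact hsp (c + 2 * j + 1) (by omega) (hodd j (ih (by omega)) (by omega))
  have hce : c % 2 = 0 := by
    by_contra hn
    refine hF ?_
    have := hodd ((F - c) / 2) (heven _ (by omega)) (by omega)
    rwa [show c + 2 * ((F - c) / 2) + 1 = F by omega] at this
  obtain ⟨k, hk⟩ : ∃ k, F = c + 2 * k := ⟨(F - c) / 2, by omega⟩
  have hsmall : ∀ x, 1 ≤ x → x ≤ 2 * k → x ∉ H := by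
    intro x hx1 hxk hx
    rcases Nat.mod_two_eq_zero_or_one x with hx2 | hx2
    · have hdiv := Nat.div_add_mod F x
      have hlt := Nat.mod_lt F (show 0 < x by omega)
      have hmem := mul_mem_of_add_closed h0 hadd hx (F / x)
      have hmod : (F / x * x) % 2 = 0 := by rw [Nat.mul_mod, hx2]; simp
      rw [mul_comm] at hdiv
      generalize F / x * x = y at *
      refine heven ((y - c) / 2) (by omega) ?_
      rwa [show c + 2 * ((y - c) / 2) = y by omega]
    · have := hodd (k - (x + 1) / 2) (heven _ (by omega)) (by omega)
      have h := hadd _ this _ hx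
      rw [show c + 2 * (k - (x + 1) / 2) + 1 + x = F by omega] at h
      exact hF h
  set L : Finset ℕ := {x ∈ range c | x ∈ H} with hL
  have memL : ∀ x, x ∈ L ↔ x < c ∧ x ∈ H := fun x => by simp [hL]
  have hAcard : #A + 1 ≤ #L + k := by
    have hsub : insert 0 A ⊆ L ∪ (range k).image (fun i => c + 2 * i + 1) := by
      intro x hx
      have hx' : x ≤ F ∧ x ∈ H := by
        rcases mem_insert.1 hx with rfl | h
        · exact ⟨by omega, h0⟩
        · exact ⟨((memA x).1 h).1.2, ((memA x).1 h).2⟩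
      rw [mem_union, memL, mem_image]
      by_cases hxc : x < c
      · exact Or.inl ⟨hxc, hx'.2⟩
      right
      have hpar : x % 2 = 1 := by
        by_contra hn
        refine heven ((x - c) / 2) (by omega) ?_
        rw [show c + 2 * ((x - c) / 2) = x by omega]
        exact hx'.2
      exact ⟨(x - c) / 2, mem_range.2 (by omega), by omega⟩
    have hle := card_le_card hsub
    rw [card_insert_of_notMem (by simp [memA])] at hle
    have hu := card_union_le L ((range k).image (fun i => c + 2 * i + 1))
    have hi := card_image_le (s := range k) (f := fun i => c + 2 * i + 1)
    rw [card_range] at hi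
    omega
  have hGcard : #L + (k - 1) ≤ #G := by
    set I := L.image (c - ·) with hI
    have hIcard : #I = #L := by
      refine card_image_of_injOn fun x hx y hy hxy => ?_
      have hx' := (memL x).1 hx
      have hy' := (memL y).1 hy
      change c - x = c - y at hxy
      omega
    have memI : ∀ x, x ∈ I → x ≤ c ∧ c - x ∈ H := by
      intro x hx
      obtain ⟨y, hy, rfl⟩ := mem_image.1 hx
      rw [memL] at hy
      exact ⟨by omega, by rw [show c - (c - y) = y by omega]; exact hy.2⟩
    set f : ℕ → ℕ := fun i => if 2 * i ∈ I then 2 * i + 1 else 2 * i with hf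
    have hfv : ∀ i, f i = 2 * i ∨ f i = 2 * i + 1 := by
      intro i; simp only [hf]; split_ifs <;> simp
    have hfI : ∀ i, f i ∉ I := by
      intro i
      simp only [hf]
      split_ifs with h
      · intro h'
        have ha := memI _ h
        have hb := memI _ h'
        refine hsp (c - (2 * i + 1)) (by omega) hb.2 ?_
        rw [show c - (2 * i + 1) + 1 = c - 2 * i by omega]
        exact ha.2
      · exact h
    have hdisj : Disjoint I ((Icc 1 (k - 1)).image f) := by
      rw [disjoint_right]
      intro x hx
      obtain ⟨i, -, rfl⟩ := mem_image.1 hx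
      exact hfI i
    have hfcard : #((Icc 1 (k - 1)).image f) = k - 1 := by
      rw [card_image_of_injective _ (fun i j hij => by
        rcases hfv i with h | h <;> rcases hfv j with h' | h' <;> omega), Nat.card_Icc]
      omega
    have hsub : I ∪ (Icc 1 (k - 1)).image f ⊆ G := by
      intro x hx
      rw [memG]
      rcases mem_union.1 hx with h | h
      · obtain ⟨y, hy, rfl⟩ := mem_image.1 h
        rw [memL] at hy
        have hne1 : y ≠ c - 1 := by rintro rfl; exact hcH' hy.2
        refine ⟨⟨by omega, by omega⟩, fun h => hcH ?_, fun h => hcH' ?_⟩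
        · have := hadd _ h _ hy.2
          rwa [show c - y + y = c by omega] at this
        · have := hadd _ h _ hy.2
          rwa [show c - y - 1 + y = c - 1 by omega] at this
      · obtain ⟨i, hi, rfl⟩ := mem_image.1 h
        rw [mem_Icc] at hi
        rcases hfv i with h | h <;> rw [h] <;>
          exact ⟨⟨by omega, by omega⟩, hsmall _ (by omega) (by omega),
            hsmall _ (by omega) (by omega)⟩
    have := card_le_card hsub
    rwa [card_union_of_disjoint hdisj, hfcard, hIcard] at this
  omega

/-- **Corollary.** Let `H` be a sparse numerical semigroup of genus `g > 1` whose
Frobenius number is even, `ℓ_g = 2g - 2r`. Then `g ≤ 4r - 1`. -/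
theorem genus_bound_even_frobenius (H : Set ℕ) (g r : ℕ) (hg : 1 < g)
    (hH : IsNumericalSemigroupOfGenus H g) (hs : IsSparse H g)
    (hF : gap H g = 2 * g - 2 * r) :
    g ≤ 4 * r - 1 := by
  classical
  obtain ⟨h0, hadd, hfin, hcard⟩ := hH
  set p : ℕ → Prop := fun n => n ∉ H with hp
  have hfin' : (Set.ofPred p).Finite := hfin
  have hcard' : hfin'.toFinset.card = g := by
    rw [← Set.ncard_eq_toFinset_card _ hfin']; exact hcard
  have hlt : g - 1 < hfin'.toFinset.card := by omega
  set F := gap H g with hFdef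
  have hFn : F = Nat.nth p (g - 1) := rfl
  have hFH : F ∉ H := Nat.nth_mem (p := p) (g - 1) (fun hf => by
    have : hf.toFinset.card = g := hcard'
    omega)
  have hcountF : Nat.count p F = g - 1 :=
    Nat.count_nth (p := p) (fun hf => by
      have : hf.toFinset.card = g := hcard'
      omega)
  have hF0 : 0 < F := by
    rcases Nat.eq_zero_or_pos F with h | h
    · rw [h] at hFH; exact absurd h0 hFH
    · exact h
  have h1 : 1 ∉ H := fun h => hFH (by simpa using mul_mem_of_add_closed h0 hadd h F)
  have hsp : ∀ x < F, x ∈ H → x + 1 ∉ H := by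
    intro x hx hxH hxH'
    have hx0 : x ≠ 0 := by rintro rfl; exact h1 hxH'
    have hx1 : x ≠ 1 := by rintro rfl; exact h1 hxH
    have hxF : x + 2 ≤ F := by
      have : x + 1 ≠ F := by rintro h; exact hFH (h ▸ hxH')
      omega
    have hc : Nat.count p (x + 2) = Nat.count p x := by
      simp [Nat.count_succ, hp, hxH, hxH']
    have hle : Nat.count p (x + 2) ≤ g - 1 := hcountF ▸ Nat.count_monotone p hxF
    have hpos : 1 ≤ Nat.count p x := by
      have := Nat.count_monotone p (show 2 ≤ x by omega)
      have h2 : Nat.count p 2 = 1 := by simp [Nat.count_succ, hp, h0, h1]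
      omega
    have hlow : Nat.nth p (Nat.count p x - 1) < x := Nat.nth_lt_of_lt_count (by omega)
    have hmem : p (Nat.nth p (Nat.count p x)) := Nat.nth_mem _ (fun hf => by
      have : hf.toFinset.card = g := hcard'
      omega)
    have hcn : Nat.count p (Nat.nth p (Nat.count p x)) = Nat.count p x :=
      Nat.count_nth (fun hf => by
        have : hf.toFinset.card = g := hcard'
        omega)
    have hhigh : x + 2 ≤ Nat.nth p (Nat.count p x) := by
      by_contra hn
      have := Nat.count_strict_mono hmem (show Nat.nth p (Nat.count p x) < x + 2 by omega)
      omega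
    have := hs (Nat.count p x) hpos (by omega)
    simp only [gap, Nat.add_sub_cancel] at this
    change Nat.nth p _ - Nat.nth p _ ≤ 2 at this
    omega
  have key := three_mul_card_lt_of_even h0 hadd hF0 (by omega) hFH hsp
  have hc1 : Nat.count p (F + 1) = g := by
    rw [Nat.count_succ, hcountF, if_pos hFH]; omega
  have hsplit : F + 1 ≤ ((Finset.Icc 1 F).filter (· ∈ H)).card + 1 + Nat.count p (F + 1) := by
    have hcount : Nat.count p (F + 1) = ((Finset.range (F + 1)).filter p).card := by
      rw [Nat.count_eq_card_filter_range]
    have hsub : Finset.range (F + 1) ⊆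
        insert 0 ((Finset.Icc 1 F).filter (· ∈ H)) ∪ (Finset.range (F + 1)).filter p := by
      intro x hx
      simp only [Finset.mem_range] at hx
      simp only [Finset.mem_union, Finset.mem_insert, Finset.mem_filter, Finset.mem_Icc,
        Finset.mem_range, hp]
      by_cases hxH : x ∈ H
      · rcases Nat.eq_zero_or_pos x with h | h
        · exact Or.inl (Or.inl h)
        · exact Or.inl (Or.inr ⟨⟨h, by omega⟩, hxH⟩)
      · exact Or.inr ⟨hx, hxH⟩
    have h1 := Finset.card_le_card hsub
    have h2 := Finset.card_union_le (insert 0 ((Finset.Icc 1 F).filter (· ∈ H)))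
      ((Finset.range (F + 1)).filter p)
    have h3 := Finset.card_insert_le 0 ((Finset.Icc 1 F).filter (· ∈ H))
    rw [Finset.card_range] at h1
    omega
  have key' : 3 * ((Finset.Icc 1 F).filter (· ∈ H)).card + 1 ≤ F := by
    convert key
  omega
end
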